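/- arXiv:1006.1694 — 7 statements merged into one kernel-verified Lean document; each statement's English description precedes it below -/
import Mathlib

section
/- Let q be a prime power, let k and r be integers with k ≤ q and 1 ≤ r ≤ k−2, and let p ∈ F_q[X] be a monic irreducible polynomial of degree k−r. Then the code C := {(v_1 p(α_1)g(α_1),…,v_q p(α_q)g(α_q), v_{q+1} g_{r−1}) : g ∈ F_q[X], deg g < r} is a linear [q+1, r, q−r+2]_q MDS code and C is contained in the extended GRS code E_k. -/
open Polynomial

open Classical in
/-- Hamming weight of a vector: the number of nonzero coordinates. -/
noncomputable def hWt {F : Type*} [Zero F] {n : ℕ} (v : Fin n → F) : ℕ :=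
  (Finset.univ.filter fun i => v i ≠ 0).card

/-- `C` is a linear `[n,k,d]_q` code: a `k`-dimensional subspace of `F^n`
whose minimum Hamming weight of nonzero codewords is exactly `d`. -/
def IsCodeWith {F : Type*} [Field F] (n k d : ℕ) (C : Submodule F (Fin n → F)) : Prop :=
  Module.finrank F C = k ∧
  (∃ v ∈ C, v ≠ 0 ∧ hWt v = d) ∧
  (∀ v ∈ C, v ≠ 0 → d ≤ hWt v)

/-- The evaluation map underlying an extended generalized Reed–Solomon code:
`f ↦ (v₁ f(α₁), …, v_q f(α_q), v_{q+1} f_{k-1})`. -/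
noncomputable def extGrsMap {F : Type*} [Field F] {q : ℕ} (k : ℕ) (α : Fin q → F)
    (v : Fin (q + 1) → F) : Polynomial F →ₗ[F] (Fin (q + 1) → F) where
  toFun f i := if h : (i : ℕ) < q then v i * f.eval (α ⟨i, h⟩) else v i * f.coeff (k - 1)
  map_add' f g := by
    funext i
    by_cases h : (i : ℕ) < q <;> simp [h, mul_add]
  map_smul' c f := by
    funext i
    by_cases h : (i : ℕ) < q <;> simp [h, smul_eq_mul] <;> ring

/-- The extended generalized Reed–Solomon code `E_k`. -/
noncomputable def ExtGRSCode {F : Type*} [Field F] {q : ℕ} (k : ℕ) (α : Fin q → F)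
    (v : Fin (q + 1) → F) : Submodule F (Fin (q + 1) → F) :=
  (Polynomial.degreeLT F k).map (extGrsMap k α v)

/-- The map `g ↦ (v₁ p(α₁) g(α₁), …, v_q p(α_q) g(α_q), v_{q+1} g_{r-1})`. -/
noncomputable def pExtGrsMap {F : Type*} [Field F] {q : ℕ} (r : ℕ) (p : Polynomial F)
    (α : Fin q → F) (v : Fin (q + 1) → F) : Polynomial F →ₗ[F] (Fin (q + 1) → F) where
  toFun g i :=
    if h : (i : ℕ) < q then v i * p.eval (α ⟨i, h⟩) * g.eval (α ⟨i, h⟩)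
    else v i * g.coeff (r - 1)
  map_add' f g := by
    funext i
    by_cases h : (i : ℕ) < q <;> simp [h, mul_add]
  map_smul' c f := by
    funext i
    by_cases h : (i : ℕ) < q <;> simp [h, smul_eq_mul] <;> ring

/-- The code `C = {(v₁ p(α₁) g(α₁), …, v_q p(α_q) g(α_q), v_{q+1} g_{r-1}) :
g ∈ F[X], deg g < r}`. -/
noncomputable def pExtGRSCode {F : Type*} [Field F] {q : ℕ} (r : ℕ) (p : Polynomial F)
    (α : Fin q → F) (v : Fin (q + 1) → F) : Submodule F (Fin (q + 1) → F) :=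
  (Polynomial.degreeLT F r).map (pExtGrsMap r p α v)

open Classical in
theorem aux_wt {q r : ℕ} {F : Type*} [Field F] [Fintype F]
    (p : Polynomial F) (hroot : ∀ x, p.eval x ≠ 0)
    (α : Fin q → F) (hα : Function.Bijective α)
    (v : Fin (q + 1) → F) (hv : ∀ i, v i ≠ 0) (g : Polynomial F) :
    hWt (pExtGrsMap r p α v g) =
      (Finset.univ.filter fun x : F => g.eval x ≠ 0).card
        + if g.coeff (r - 1) ≠ 0 then 1 else 0 := by
  unfold hWt
  rw [Finset.card_filter, Fin.sum_univ_castSucc, Finset.card_filter,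
    ← Function.Bijective.sum_comp hα (fun x => if g.eval x ≠ 0 then 1 else 0)]
  simp [pExtGrsMap, hv, hroot]

open Classical in
theorem aux_compl {F : Type*} [Field F] [Fintype F] (g : Polynomial F) (hg : g ≠ 0) :
    (Finset.univ.filter fun x : F => g.eval x ≠ 0).card + g.roots.toFinset.card
      = Fintype.card F := by
  have h : g.roots.toFinset = Finset.univ.filter fun x : F => g.eval x = 0 := by
    ext x; simp [hg]
  rw [h, add_comm]
  have := Finset.card_filter_add_card_filter_not (s := (Finset.univ : Finset F))
    (fun x : F => g.eval x = 0)
  simpa using this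

theorem aux_lower {q r : ℕ} {F : Type*} [Field F] [Fintype F]
    (hcard : Fintype.card F = q) (hr1 : 1 ≤ r) (hrq : r ≤ q)
    (p : Polynomial F) (hroot : ∀ x, p.eval x ≠ 0)
    (α : Fin q → F) (hα : Function.Bijective α)
    (v : Fin (q + 1) → F) (hv : ∀ i, v i ≠ 0) (g : Polynomial F) (hg : g ≠ 0)
    (hgd : g ∈ Polynomial.degreeLT F r) :
    q - r + 2 ≤ hWt (pExtGrsMap r p α v g) := by
  classical
  rw [aux_wt p hroot α hα v hv g]
  have h1 := aux_compl g hg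
  have h2 : g.roots.toFinset.card ≤ g.natDegree :=
    (Multiset.toFinset_card_le _).trans (Polynomial.card_roots' g)
  have h3 : g.natDegree < r := by
    rw [Polynomial.mem_degreeLT] at hgd
    exact (Polynomial.natDegree_lt_iff_degree_lt hg).2 hgd
  by_cases hc : g.coeff (r - 1) = 0
  · have h4 : g.natDegree ≠ r - 1 := by
      intro h
      rw [← h] at hc
      exact hg (Polynomial.leadingCoeff_eq_zero.1 hc)
    simp only [hc, ne_eq, not_true_eq_false, if_false] at *
    omega
  · simp only [hc, ne_eq, not_false_eq_true, if_true] at *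
    omega

theorem aux_wt_zero {F : Type*} [Zero F] {n : ℕ} : hWt (0 : Fin n → F) = 0 := by
  simp [hWt]

theorem stmt4 {q k r : ℕ} (hq : IsPrimePow q) {F : Type*} [Field F] [Fintype F]
    (hcard : Fintype.card F = q) (hkq : k ≤ q) (hr1 : 1 ≤ r) (hrk : r ≤ k - 2)
    (p : Polynomial F) (hp : p.Monic) (hpirr : Irreducible p)
    (hpdeg : p.degree = ((k - r : ℕ) : WithBot ℕ))
    (α : Fin q → F) (hα : Function.Bijective α)
    (v : Fin (q + 1) → F) (hv : ∀ i, v i ≠ 0) :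
    IsCodeWith (q + 1) r (q - r + 2) (pExtGRSCode r p α v) ∧
    pExtGRSCode r p α v ≤ ExtGRSCode k α v := by
  have hroot : ∀ x, p.eval x ≠ 0 := by
    intro x hx
    have := Polynomial.degree_eq_one_of_irreducible_of_root hpirr hx
    rw [hpdeg] at this
    have h2 : k - r = 1 := by exact_mod_cast this
    omega
  have hrq : r ≤ q := by omega
  have hnd : p.natDegree = k - r := Polynomial.natDegree_eq_of_degree_eq_some hpdeg
  have low := fun g => aux_lower hcard hr1 hrq p hroot α hα v hv g
  refine ⟨⟨?_, ?_, ?_⟩, ?_⟩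
  · unfold pExtGRSCode
    rw [← LinearMap.range_domRestrict, LinearMap.finrank_range_of_inj,
      (Polynomial.degreeLTEquiv F r).finrank_eq, Module.finrank_fin_fun]
    rw [← LinearMap.ker_eq_bot, LinearMap.ker_eq_bot']
    rintro ⟨g, hg⟩ h
    by_contra hne
    have h0 : g ≠ 0 := fun h => hne (by simp [h])
    have h1 := low g h0 hg
    rw [LinearMap.domRestrict_apply] at h
    simp only at h
    rw [h, aux_wt_zero] at h1
    omega
  · classical
    obtain ⟨S, -, hS⟩ := Finset.exists_subset_card_eq
      (s := (Finset.univ : Finset F)) (n := r - 1) (by rw [Finset.card_univ]; omega)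
    let g : Polynomial F := ∏ a ∈ S, (X - C a)
    have hgm : g.Monic := Polynomial.monic_prod_X_sub_C _ _
    have hgn : g.natDegree = r - 1 := by
      simp only [g]; rw [Polynomial.natDegree_finsetProd_X_sub_C_eq_card, hS]
    have hgr : g.roots.toFinset = S := by
      simp only [g]; rw [Polynomial.roots_prod_X_sub_C]; simp
    have hgd : g ∈ Polynomial.degreeLT F r := by
      rw [Polynomial.mem_degreeLT, ← Polynomial.natDegree_lt_iff_degree_lt hgm.ne_zero]
      omega
    have hw : hWt (pExtGrsMap r p α v g) = q - r + 2 := by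
      rw [aux_wt p hroot α hα v hv g]
      have h1 := aux_compl g hgm.ne_zero
      have hc : g.coeff (r - 1) = 1 := by rw [← hgn]; exact hgm
      rw [hgr, hS, hcard] at h1
      rw [hc, if_pos one_ne_zero]
      omega
    refine ⟨_, Submodule.mem_map_of_mem hgd, ?_, hw⟩
    intro h
    rw [h, aux_wt_zero] at hw
    omega
  · rintro _ ⟨g, hg, rfl⟩ hne
    exact low g (fun h => hne (by simp [h])) hg
  · rintro _ ⟨g, hg, rfl⟩
    have hg' : g.natDegree ≤ r - 1 := by
      by_cases h0 : g = 0
      · simp [h0]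
      · have := (Polynomial.natDegree_lt_iff_degree_lt h0).2 (Polynomial.mem_degreeLT.1 hg)
        omega
    refine ⟨p * g, ?_, ?_⟩
    · refine Polynomial.mem_degreeLT.2 (lt_of_le_of_lt (Polynomial.degree_le_of_natDegree_le
        (Polynomial.natDegree_mul_le_of_le hnd.le hg')) ?_)
      have : k - r + (r - 1) < k := by omega
      exact_mod_cast this
    · have hc : (p * g).coeff (k - 1) = g.coeff (r - 1) := by
        have h := Polynomial.coeff_mul_add_eq_of_natDegree_le hnd.le hg'
        have e : k - r + (r - 1) = k - 1 := by omega
        have h1 : p.coeff (k - r) = 1 := by rw [← hnd]; exact hp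
        rw [e, h1, one_mul] at h
        exact h
      funext i
      simp [extGrsMap, pExtGrsMap, hc, mul_assoc]
end

section
/- Let q be a prime power and n, k positive integers with k ≤ n−1. If there exist F_q-linear codes C ⊂ C′ in F_q^n with C a linear [n, k, n−k+1]_q MDS code and C′ a linear [n, k+1, n−k]_q MDS code, then there exists a linear [n+1, k+1, n−k+1]_q MDS code. -/
theorem hWt_cons_aux {F : Type*} [Zero F] {n : ℕ} (a : F) (v : Fin n → F) :
    (a = 0 → hWt (Fin.cons a v : Fin (n + 1) → F) = hWt v) ∧
    (a ≠ 0 → hWt (Fin.cons a v : Fin (n + 1) → F) = hWt v + 1) := by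
  classical
  unfold hWt
  constructor <;> intro h
  · simp only [Finset.card_filter, Fin.sum_univ_succ, Fin.cons_zero, Fin.cons_succ]
    simp [h]
  · simp only [Finset.card_filter, Fin.sum_univ_succ, Fin.cons_zero, Fin.cons_succ]
    simp [h, add_comm]

theorem stmt7 {q n k : ℕ} (hq : IsPrimePow q)
    {F : Type*} [Field F] [Fintype F] (hcard : Fintype.card F = q)
    (hn : 1 ≤ n) (hk : 1 ≤ k) (hkn : k ≤ n - 1)
    (C C' : Submodule F (Fin n → F)) (hCC' : C < C')
    (hC : IsCodeWith n k (n - k + 1) C)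
    (hC' : IsCodeWith n (k + 1) (n - k) C') :
    ∃ D : Submodule F (Fin (n + 1) → F),
      IsCodeWith (n + 1) (k + 1) (n - k + 1) D := by
  obtain ⟨hCd, ⟨v, hvC, hv0, hvw⟩, hCm⟩ := hC
  obtain ⟨hCd', -, hCm'⟩ := hC'
  obtain ⟨hle, x, hxC', hxC⟩ := SetLike.lt_iff_le_and_exists.1 hCC'
  obtain ⟨f, hfx, hfC⟩ := Submodule.exists_le_ker_of_notMem hxC
  have hK : C = C' ⊓ LinearMap.ker f := by
    apply Submodule.eq_of_le_of_finrank_le (le_inf hle hfC)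
    have hlt : C' ⊓ LinearMap.ker f < C' := by
      refine lt_of_le_of_ne inf_le_left fun h => hfx ?_
      have : x ∈ C' ⊓ LinearMap.ker f := by rw [h]; exact hxC'
      exact this.2
    have := Submodule.finrank_lt_finrank_of_lt hlt
    omega
  let g : (Fin n → F) →ₗ[F] (Fin (n + 1) → F) :=
    { toFun := fun w => Fin.cons (f w) w
      map_add' := fun a b => by
        ext i; refine Fin.cases ?_ (fun j => ?_) i <;> simp
      map_smul' := fun c a => by
        ext i; refine Fin.cases ?_ (fun j => ?_) i <;> simp }
  have hg : ∀ w, g w = Fin.cons (f w) w := fun w => rfl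
  have hinj : Function.Injective g := fun a b h => by
    rw [hg, hg] at h
    exact (Fin.cons_injective2 h).2
  refine ⟨C'.map g, ?_, ⟨g v, Submodule.mem_map_of_mem (hle hvC), ?_, ?_⟩, ?_⟩
  · rw [← hCd']
    exact (Submodule.equivMapOfInjective g hinj C').finrank_eq.symm
  · intro h; exact hv0 (hinj (h.trans (map_zero g).symm))
  · rw [hg, (hWt_cons_aux _ _).1 (hfC hvC), hvw]
  · rintro _ ⟨w, hw, rfl⟩ hw0
    have hw1 : w ≠ 0 := by rintro rfl; exact hw0 (map_zero g)
    by_cases h : f w = 0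
    · rw [hg, (hWt_cons_aux _ _).1 h]
      exact hCm w (by rw [hK]; exact ⟨hw, h⟩) hw1
    · rw [hg, (hWt_cons_aux _ _).2 h]
      have := hCm' w hw hw1
      omega
end

section
/- Let q = 2^m with m ≥ 2. Then there exist F_q-linear codes C ⊂ C′ in F_q^{q+1} such that C is a linear [q+1, 2, q]_q MDS code and C′ is a linear [q+1, 3, q−1]_q MDS code. -/
/-- Evaluation of a quadratic form on the conic. -/
def evC {F : Type*} [Field F] (a b c : F) : Option F → F
  | none => c
  | some t => a + b * t + c * t ^ 2

/-- Encoder of the 3-dimensional code. -/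
def enc3 {F : Type*} [Field F] {n : ℕ} (e : Fin n ≃ Option F) :
    (Fin 3 → F) →ₗ[F] (Fin n → F) where
  toFun p i := evC (p 0) (p 1) (p 2) (e i)
  map_add' p r := by
    ext i
    cases h : e i <;> simp [evC, h]
    ring
  map_smul' k p := by
    ext i
    cases h : e i <;> simp [evC, h]
    ring

/-- Encoder of the 2-dimensional code. -/
def enc2 {F : Type*} [Field F] {n : ℕ} (e : Fin n ≃ Option F) :
    (Fin 2 → F) →ₗ[F] (Fin n → F) where
  toFun p i := evC (p 0) 0 (p 1) (e i)
  map_add' p r := by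
    ext i
    cases h : e i <;> simp [evC, h]
    ring
  map_smul' k p := by
    ext i
    cases h : e i <;> simp [evC, h]
    ring

open Classical in
lemma hWt_evC {F : Type*} [Field F] [Fintype F] {n : ℕ} (e : Fin n ≃ Option F) (g : Option F → F) :
    hWt (fun i => g (e i)) + (Finset.univ.filter fun o => g o = 0).card = Fintype.card F + 1 := by
  have h1 : hWt (fun i => g (e i)) = (Finset.univ.filter fun o => g o ≠ 0).card := by
    unfold hWt
    refine Finset.card_bij (fun i _ => e i) ?_ ?_ ?_
    · intro i hi; simpa using hi
    · intro i _ j _ h; exact e.injective h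
    · intro o ho; exact ⟨e.symm o, by simpa using ho, by simp⟩
  rw [h1, add_comm, Finset.card_filter_add_card_filter_not, Finset.card_univ, Fintype.card_option]

open Classical in
lemma zeros3 {F : Type*} [Field F] [Fintype F] (a b c : F) (h : ¬ (a = 0 ∧ b = 0 ∧ c = 0)) :
    (Finset.univ.filter fun o => evC a b c o = 0).card ≤ 2 := by
  by_contra hc
  push Not at hc
  have lin : ∀ s t : F, s ≠ t → a + b * s = 0 → a + b * t = 0 → a = 0 ∧ b = 0 := by
    intro s t hst h1 h2
    have : b * (s - t) = 0 := by linear_combination h1 - h2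
    have hb : b = 0 := (mul_eq_zero.1 this).resolve_right (sub_ne_zero.2 hst)
    subst hb
    exact ⟨by simpa using h1, rfl⟩
  obtain ⟨x, y, z, hx, hy, hz, hxy, hxz, hyz⟩ := Finset.two_lt_card_iff.1 hc
  simp only [Finset.mem_filter, Finset.mem_univ, true_and] at hx hy hz
  have key : ∀ s t : F, s ≠ t → c = 0 → evC a b c (some s) = 0 → evC a b c (some t) = 0 → False := by
    intro s t hst h0 h1 h2
    simp only [evC, h0, zero_mul, add_zero] at h1 h2
    obtain ⟨ha, hb⟩ := lin s t hst h1 h2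
    exact h ⟨ha, hb, h0⟩
  rcases x with _ | x <;> rcases y with _ | y <;> rcases z with _ | z <;>
    simp only [ne_eq, not_true_eq_false, Option.some.injEq] at hxy hxz hyz
  · exact key y z hyz hx hy hz
  · exact key x z hxz hy hx hz
  · exact key x y hxy hz hx hy
  · have hx' := hx
    have hy' := hy
    simp only [evC] at hx hy hz
    have e1 : b + c * (x + y) = 0 :=
      mul_left_cancel₀ (sub_ne_zero.2 hxy) (by linear_combination hx - hy)
    have e2 : b + c * (x + z) = 0 :=
      mul_left_cancel₀ (sub_ne_zero.2 hxz) (by linear_combination hx - hz)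
    have e3 : c = 0 :=
      mul_left_cancel₀ (sub_ne_zero.2 hyz) (by linear_combination e1 - e2)
    exact key x y hxy e3 hx' hy'

open Classical in
lemma zeros2 {F : Type*} [Field F] [Fintype F] [CharP F 2] (a c : F) (h : ¬ (a = 0 ∧ c = 0)) :
    (Finset.univ.filter fun o => evC a 0 c o = 0).card ≤ 1 := by
  by_contra hc
  push Not at hc
  obtain ⟨x, y, hx, hy, hxy⟩ := Finset.one_lt_card_iff.1 hc
  simp only [Finset.mem_filter, Finset.mem_univ, true_and] at hx hy
  rcases x with _ | x <;> rcases y with _ | y <;>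
    simp only [ne_eq, not_true_eq_false, Option.some.injEq] at hxy <;> simp only [evC] at hx hy
  · subst hx; exact h ⟨by simpa using hy, rfl⟩
  · subst hy; exact h ⟨by simpa using hx, rfl⟩
  · have h2 : (2 : F) = 0 := CharTwo.two_eq_zero
    have e1 : c * (x - y) ^ 2 = 0 := by linear_combination hx - hy + c * (y ^ 2 - x * y) * h2
    have hc0 : c = 0 := (mul_eq_zero.1 e1).resolve_right (pow_ne_zero _ (sub_ne_zero.2 hxy))
    subst hc0
    exact h ⟨by simpa using hx, rfl⟩

lemma hWt_zero' {F : Type*} [Field F] {n : ℕ} : hWt (0 : Fin n → F) = 0 := by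
  simp [hWt]

theorem stmt9 {m : ℕ} (hm : 2 ≤ m) {q : ℕ} (hq : q = 2 ^ m)
    {F : Type*} [Field F] [Fintype F] (hcard : Fintype.card F = q) :
    ∃ C C' : Submodule F (Fin (q + 1) → F), C < C' ∧
      IsCodeWith (q + 1) 2 q C ∧
      IsCodeWith (q + 1) 3 (q - 1) C' := by
  classical
  have hq4 : 4 ≤ q := by
    rw [hq]; calc 4 = 2 ^ 2 := by norm_num
      _ ≤ 2 ^ m := Nat.pow_le_pow_right (by norm_num) hm
  have : CharP F 2 := by
    have : Fact (Nat.Prime 2) := ⟨Nat.prime_two⟩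
    exact charP_of_card_eq_prime_pow (hcard.trans hq)
  let e : Fin (q + 1) ≃ Option F := Fintype.equivOfCardEq (by simp [hcard])
  have w3 : ∀ p : Fin 3 → F, p ≠ 0 → q - 1 ≤ hWt (enc3 e p) := by
    intro p hp
    have h1 := hWt_evC e (evC (p 0) (p 1) (p 2))
    have h2 := zeros3 (p 0) (p 1) (p 2) (by
      rintro ⟨h0, h1, h2⟩; apply hp; ext i; fin_cases i <;> simpa)
    change q - 1 ≤ hWt (fun i => evC (p 0) (p 1) (p 2) (e i))
    omega
  have w2 : ∀ p : Fin 2 → F, p ≠ 0 → q ≤ hWt (enc2 e p) := by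
    intro p hp
    have h1 := hWt_evC e (evC (p 0) 0 (p 1))
    have h2 := zeros2 (p 0) (p 1) (by
      rintro ⟨h0, h1⟩; apply hp; ext i; fin_cases i <;> simpa)
    change q ≤ hWt (fun i => evC (p 0) 0 (p 1) (e i))
    omega
  have i3 : Function.Injective (enc3 e) := by
    rw [injective_iff_map_eq_zero]
    intro p hp
    by_contra h
    have := w3 p h
    rw [hp, hWt_zero'] at this
    omega
  have i2 : Function.Injective (enc2 e) := by
    rw [injective_iff_map_eq_zero]
    intro p hp
    by_contra h
    have := w2 p h
    rw [hp, hWt_zero'] at this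
    omega
  have f3 : Module.finrank F (LinearMap.range (enc3 e)) = 3 := by
    rw [LinearMap.finrank_range_of_inj i3]; simp
  have f2 : Module.finrank F (LinearMap.range (enc2 e)) = 2 := by
    rw [LinearMap.finrank_range_of_inj i2]; simp
  refine ⟨LinearMap.range (enc2 e), LinearMap.range (enc3 e), lt_of_le_of_ne ?_ ?_,
    ⟨f2, ?_, ?_⟩, ⟨f3, ?_, ?_⟩⟩
  · rintro _ ⟨p, rfl⟩
    exact ⟨![p 0, 0, p 1], rfl⟩
  · intro h
    rw [h, f3] at f2
    omega
  · have hp : (![1, 0] : Fin 2 → F) ≠ 0 := fun h => one_ne_zero (congrFun h 0)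
    refine ⟨_, ⟨![1, 0], rfl⟩, fun h => hp (i2 (by rw [h, map_zero])), le_antisymm ?_ (w2 _ hp)⟩
    have h1 := hWt_evC e (evC (1 : F) 0 0)
    have h2 : 0 < (Finset.univ.filter fun o => evC (1 : F) 0 0 o = 0).card :=
      Finset.card_pos.2 ⟨none, by simp [evC]⟩
    change hWt (fun i => evC (1 : F) 0 0 (e i)) ≤ q
    omega
  · rintro _ ⟨p, rfl⟩ h
    exact w2 p (fun h0 => h (by rw [h0, map_zero]))
  · have hp : (![0, -1, 1] : Fin 3 → F) ≠ 0 := fun h => one_ne_zero (congrFun h 2)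
    refine ⟨_, ⟨![0, -1, 1], rfl⟩, fun h => hp (i3 (by rw [h, map_zero])),
      le_antisymm ?_ (w3 _ hp)⟩
    have h1 := hWt_evC e (evC (0 : F) (-1) 1)
    have h2 : 1 < (Finset.univ.filter fun o => evC (0 : F) (-1) 1 o = 0).card :=
      Finset.one_lt_card_iff.2 ⟨some 0, some 1, by simp [evC], by simp [evC], by simp⟩
    change hWt (fun i => evC (0 : F) (-1) 1 (e i)) ≤ q - 1
    omega
  · rintro _ ⟨p, rfl⟩ h
    exact w3 p (fun h0 => h (by rw [h0, map_zero]))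
end

section
/- Let q = 2^m with m ≥ 2. Then there exist F_q-linear codes D ⊆ C in F_q^{q+2} such that D is a linear [q+2, 3, q]_q MDS code and C is a linear [q+2, q−1, 4]_q MDS code. -/
/-- Any three vectors of the family are independent. -/
def ArcP {F : Type*} [Field F] {ι : Type*} (g : ι → Fin 3 → F) : Prop :=
  ∀ i j k, i ≠ j → i ≠ k → j ≠ k → (Matrix.of ![g i, g j, g k]).det ≠ 0

/-- The code generated by the arc. -/
def genMap {F : Type*} [Field F] {n : ℕ} (g : Fin n → Fin 3 → F) :
    (Fin 3 → F) →ₗ[F] (Fin n → F) where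
  toFun a := fun i => ∑ t, g i t * a t
  map_add' a b := by ext i; simp [mul_add, Finset.sum_add_distrib]
  map_smul' r a := by ext i; simp [Finset.mul_sum, mul_left_comm]

/-- The parity check map of the arc. -/
def chkMap {F : Type*} [Field F] {n : ℕ} (g : Fin n → Fin 3 → F) :
    (Fin n → F) →ₗ[F] (Fin 3 → F) where
  toFun v := fun t => ∑ i, v i * g i t
  map_add' a b := by ext i; simp [add_mul, Finset.sum_add_distrib]
  map_smul' r a := by ext i; simp [Finset.mul_sum, mul_assoc]

theorem arc_zero {F : Type*} [Field F] {ι : Type*} {g : ι → Fin 3 → F} (hg : ArcP g)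
    {i j k : ι} (hij : i ≠ j) (hik : i ≠ k) (hjk : j ≠ k) (a : Fin 3 → F)
    (h1 : ∑ t, g i t * a t = 0) (h2 : ∑ t, g j t * a t = 0) (h3 : ∑ t, g k t * a t = 0) :
    a = 0 := by
  apply Matrix.eq_zero_of_mulVec_eq_zero (hg i j k hij hik hjk)
  ext r
  fin_cases r <;> simpa [Matrix.mulVec, dotProduct]

theorem arc_ind {F : Type*} [Field F] {ι : Type*} {g : ι → Fin 3 → F} (hg : ArcP g)
    {i j k : ι} (hij : i ≠ j) (hik : i ≠ k) (hjk : j ≠ k) (a b c : F)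
    (h : ∀ t, a * g i t + b * g j t + c * g k t = 0) : a = 0 ∧ b = 0 ∧ c = 0 := by
  have := Matrix.eq_zero_of_vecMul_eq_zero (hg i j k hij hik hjk) (v := ![a, b, c]) (by
    ext t
    simpa [Matrix.vecMul, dotProduct, Fin.sum_univ_three] using h t)
  exact ⟨congrFun this 0, congrFun this 1, congrFun this 2⟩

theorem arc_span {F : Type*} [Field F] {ι : Type*} {g : ι → Fin 3 → F} (hg : ArcP g)
    {i j k : ι} (hij : i ≠ j) (hik : i ≠ k) (hjk : j ≠ k) (y : Fin 3 → F) :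
    ∃ a b c : F, ∀ t, a * g i t + b * g j t + c * g k t = y t := by
  have hu : IsUnit (Matrix.of ![g i, g j, g k]) :=
    (Matrix.isUnit_iff_isUnit_det _).2 (isUnit_iff_ne_zero.2 (hg i j k hij hik hjk))
  obtain ⟨v, hv⟩ := Matrix.vecMul_surjective_iff_isUnit.2 hu y
  refine ⟨v 0, v 1, v 2, fun t => ?_⟩
  rw [← hv]
  simp [Matrix.vecMul, dotProduct, Fin.sum_univ_three]

theorem arc_gen {F : Type*} [Field F] {n : ℕ} (hn : 3 ≤ n) {g : Fin n → Fin 3 → F}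
    (hg : ArcP g) : IsCodeWith n 3 (n - 2) (LinearMap.range (genMap g)) := by
  classical
  have hz : ∀ v ∈ LinearMap.range (genMap g), v ≠ 0 → n - 2 ≤ hWt v := by
    rintro _ ⟨a, rfl⟩ hv
    by_contra hlt
    have hc := Finset.card_filter_add_card_filter_not (s := (Finset.univ : Finset (Fin n)))
      (fun i => genMap g a i ≠ 0)
    rw [Finset.card_univ, Fintype.card_fin] at hc
    unfold hWt at hlt
    have h3 : 2 < (Finset.univ.filter fun i => ¬ (genMap g a i ≠ 0)).card := by
      have : (Finset.univ.filter fun i => genMap g a i ≠ 0).card < n - 2 := by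
        convert not_le.1 hlt
      omega
    obtain ⟨i, j, k, hi, hj, hk, hij, hik, hjk⟩ := Finset.two_lt_card_iff.1 h3
    simp only [Finset.mem_filter, Finset.mem_univ, true_and, not_not] at hi hj hk
    apply hv
    rw [arc_zero hg hij hik hjk a hi hj hk, map_zero]
  refine ⟨?_, ?_, hz⟩
  · rw [LinearMap.finrank_range_of_inj]
    · simp
    · rw [← LinearMap.ker_eq_bot, LinearMap.ker_eq_bot']
      intro a ha
      exact arc_zero hg (i := ⟨0, by omega⟩) (j := ⟨1, by omega⟩) (k := ⟨2, by omega⟩)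
        (by simp) (by simp) (by simp) a (congrFun ha _) (congrFun ha _) (congrFun ha _)
  · let i : Fin n := ⟨0, by omega⟩
    let j : Fin n := ⟨1, by omega⟩
    let k : Fin n := ⟨2, by omega⟩
    have hij : i ≠ j := by simp [i, j]
    have hik : i ≠ k := by simp [i, k]
    have hjk : j ≠ k := by simp [j, k]
    let a := crossProduct (g i) (g j)
    have h1 : genMap g a i = 0 := by
      simp [genMap, a, crossProduct, Fin.sum_univ_three]; ring
    have h2 : genMap g a j = 0 := by
      simp [genMap, a, crossProduct, Fin.sum_univ_three]; ring
    have h3 : genMap g a k ≠ 0 := by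
      have := hg i j k hij hik hjk
      rw [Matrix.det_fin_three] at this
      intro h
      apply this
      rw [← h]
      simp [genMap, a, crossProduct, Fin.sum_univ_three]; ring
    have h0 : genMap g a ≠ 0 := fun h => h3 (congrFun h k)
    refine ⟨genMap g a, ⟨a, rfl⟩, h0, le_antisymm ?_ (hz _ ⟨a, rfl⟩ h0)⟩
    have : hWt (genMap g a) ≤ ((Finset.univ : Finset (Fin n)) \ {i, j}).card := by
      unfold hWt
      apply Finset.card_le_card
      intro t ht
      simp only [Finset.mem_filter, Finset.mem_univ, true_and] at ht
      simp only [Finset.mem_sdiff, Finset.mem_univ, true_and, Finset.mem_insert,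
        Finset.mem_singleton]
      rintro (rfl | rfl)
      · exact ht h1
      · exact ht h2
    rwa [Finset.card_sdiff_of_subset (Finset.subset_univ _), Finset.card_pair hij,
      Finset.card_univ, Fintype.card_fin] at this

theorem arc_chk {F : Type*} [Field F] {n : ℕ} (hn : 4 ≤ n) {g : Fin n → Fin 3 → F}
    (hg : ArcP g) : IsCodeWith n (n - 3) 4 (LinearMap.ker (chkMap g)) := by
  classical
  have hz : ∀ v ∈ LinearMap.ker (chkMap g), v ≠ 0 → 4 ≤ hWt v := by
    intro v hv h0
    by_contra hlt
    have hle : (Finset.univ.filter fun i => v i ≠ 0).card ≤ 3 := by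
      have : hWt v ≤ 3 := by omega
      unfold hWt at this
      convert this
    obtain ⟨S, hS, hS3⟩ := Finset.exists_superset_card_eq hle (by simp; omega)
    obtain ⟨i, j, k, hij, hik, hjk, rfl⟩ := Finset.card_eq_three.1 hS3
    have hout : ∀ t, t ∉ ({i, j, k} : Finset (Fin n)) → v t = 0 := by
      intro t ht
      by_contra hne
      exact ht (hS (by simp [hne]))
    have := arc_ind hg hij hik hjk (v i) (v j) (v k) (by
      intro t
      have h := congrFun (LinearMap.mem_ker.1 hv) t
      change ∑ i, v i * g i t = 0 at h
      rw [← Finset.sum_subset (Finset.subset_univ {i, j, k})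
        (fun x _ hx => by rw [hout x hx, zero_mul])] at h
      rw [Finset.sum_insert (by simp [hij, hik]), Finset.sum_pair hjk] at h
      rw [← h]; ring)
    apply h0
    ext t
    by_cases ht : t ∈ ({i, j, k} : Finset (Fin n))
    · simp only [Finset.mem_insert, Finset.mem_singleton] at ht
      rcases ht with rfl | rfl | rfl
      · exact this.1
      · exact this.2.1
      · exact this.2.2
    · exact hout t ht
  let i : Fin n := ⟨0, by omega⟩
  let j : Fin n := ⟨1, by omega⟩
  let k : Fin n := ⟨2, by omega⟩
  let l : Fin n := ⟨3, by omega⟩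
  have hij : i ≠ j := by simp [i, j]
  have hik : i ≠ k := by simp [i, k]
  have hjk : j ≠ k := by simp [j, k]
  have hil : i ≠ l := by simp [i, l]
  have hjl : j ≠ l := by simp [j, l]
  have hkl : k ≠ l := by simp [k, l]
  have hs : ∀ (x : Fin n) (c : F) t, chkMap g (Pi.single x c) t = c * g x t := by
    intro x c t
    change ∑ i, (Pi.single x c : Fin n → F) i * g i t = _
    rw [Finset.sum_eq_single x]
    · simp
    · intro b _ hb; simp [hb]
    · simp
  refine ⟨?_, ?_, hz⟩
  · have hsurj : Function.Surjective (chkMap g) := by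
      intro y
      obtain ⟨a, b, c, h⟩ := arc_span hg hij hik hjk y
      refine ⟨Pi.single i a + Pi.single j b + Pi.single k c, ?_⟩
      ext t
      rw [map_add, map_add, Pi.add_apply, Pi.add_apply, hs, hs, hs, h]
    have := LinearMap.finrank_range_add_finrank_ker (chkMap g)
    rw [LinearMap.range_eq_top.2 hsurj, finrank_top] at this
    simp only [Module.finrank_fin_fun] at this
    omega
  · obtain ⟨a, b, c, h⟩ := arc_span hg hij hik hjk (g l)
    let v : Fin n → F := Pi.single i a + Pi.single j b + Pi.single k c + Pi.single l (-1)
    have hv : v ∈ LinearMap.ker (chkMap g) := by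
      rw [LinearMap.mem_ker]
      ext t
      rw [map_add, map_add, map_add, Pi.add_apply, Pi.add_apply, Pi.add_apply,
        hs, hs, hs, hs, h]
      simp
    have h0 : v ≠ 0 := by
      intro h
      have := congrFun h l
      simp [v, hil.symm, hjl.symm, hkl.symm] at this
    refine ⟨v, hv, h0, le_antisymm ?_ (hz v hv h0)⟩
    have : hWt v ≤ ({i, j, k, l} : Finset (Fin n)).card := by
      unfold hWt
      apply Finset.card_le_card
      intro t ht
      simp only [Finset.mem_filter, Finset.mem_univ, true_and] at ht
      by_contra hc
      simp only [Finset.mem_insert, Finset.mem_singleton, not_or] at hc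
      apply ht
      simp [v, hc]
    exact this.trans Finset.card_le_four

/-- The weighted hyperoval. -/
def hov {F : Type*} [Field F] (w : F → F) (s : F) : F ⊕ Bool → Fin 3 → F
  | Sum.inl x => ![w x, w x * x, w x * x ^ 2]
  | Sum.inr false => ![0, s, 0]
  | Sum.inr true => ![0, 0, s]

theorem hov_arc {F : Type*} [Field F] (h2 : (2 : F) = 0) (w : F → F) (s : F)
    (hw : ∀ x, w x ≠ 0) (hs : s ≠ 0) : ArcP (hov w s) := by
  have key : ∀ x y : F, x ≠ y → x ^ 2 ≠ y ^ 2 := by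
    intro x y hxy h
    apply hxy
    have : (x - y) ^ 2 = 0 := by linear_combination h - (x * y - y ^ 2) * h2
    exact sub_eq_zero.1 (pow_eq_zero_iff (two_ne_zero)|>.1 this)
  rintro (x | _ | _) (y | _ | _) (z | _ | _) h1 h3 h4 <;>
    simp only [ne_eq, not_true_eq_false, Sum.inl.injEq] at h1 h3 h4
  all_goals
    try have hx := hw x
    try have hy := hw y
    try have hz := hw z
    try have kxy := key x y
    try have kxz := key x z
    try have kyz := key y z
    clear key
    intro h
    simp [hov, Matrix.det_fin_three] at h
    try grind

theorem exists_w {F : Type*} [Field F] [Fintype F] {m : ℕ} (hm : 2 ≤ m)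
    (hcard : Fintype.card F = 2 ^ m) :
    ∃ w : F → F, (∀ x, w x ≠ 0) ∧ ∑ x, w x = 0 ∧ ∑ x, w x * x = 0 ∧ ∑ x, w x * x ^ 2 = 0 ∧
      ∑ x, w x * x ^ 4 = 0 ∧ ∑ x, w x * x ^ 3 ≠ 0 := by
  classical
  have hc0 : ((Fintype.card F : ℕ) : F) = 0 := FiniteField.cast_card_eq_zero F
  have h3 : ∑ x : F, (if x = 0 then (0 : F) else 1) = -1 := by
    have : ∀ x : F, (if x = 0 then (0 : F) else 1) = 1 - (if x = 0 then 1 else 0) := by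
      intro x; split_ifs <;> simp
    simp only [this, Finset.sum_sub_distrib]
    simp [hc0]
  have hp : ∀ i, i < Fintype.card F - 1 → ∑ x : F, x ^ i = 0 :=
    fun i hi => FiniteField.sum_pow_lt_card_sub_one F i hi
  rcases hm.eq_or_lt with rfl | hm
  · have e0 := hp 0 (by omega)
    have e1 := hp 1 (by omega)
    have e2 := hp 2 (by omega)
    refine ⟨fun _ => 1, by simp, by simpa using e0, by simpa using e1, by simpa using e2, ?_, ?_⟩
    · rw [← e1]
      refine Finset.sum_congr rfl fun x _ => ?_
      have := FiniteField.pow_card x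
      rw [hcard] at this
      simpa using this
    · have : ∀ x : F, 1 * x ^ 3 = (if x = 0 then (0 : F) else 1) := by
        intro x
        split_ifs with h
        · simp [h]
        · have := FiniteField.pow_card_sub_one_eq_one x h
          rw [hcard] at this
          simpa using this
      simp only [this, h3]
      simp
  · have h8 : 8 ≤ Fintype.card F := by
      rw [hcard]; exact Nat.pow_le_pow_right (n := 2) (by norm_num) hm
    have h2 : (2 : F) = 0 := by
      rw [hcard] at hc0
      push_cast at hc0
      exact pow_eq_zero_iff (by omega) |>.1 hc0
    have hns : ¬ Function.Surjective (fun y : F => y ^ 3 + y ^ 6) := by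
      intro h
      have hi := Finite.injective_iff_surjective.2 h
      have : (0 : F) = 1 := hi (by norm_num; exact h2.symm)
      exact zero_ne_one this
    simp only [Function.Surjective, not_forall, not_exists] at hns
    obtain ⟨c, hc⟩ := hns
    have hinv : ∀ i, i < Fintype.card F - 1 → ∑ x : F, (x⁻¹) ^ i = 0 := by
      intro i hi
      rw [← hp i hi]
      exact Equiv.sum_comp (Equiv.mk (fun x : F => x⁻¹) (fun x => x⁻¹) inv_inv inv_inv) (fun x => x ^ i)
    have P := fun i (hi : i < 7) => hp i (by omega)
    have Q := fun i (hi : i < 7) => hinv i (by omega)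
    have p0 := P 0 (by norm_num)
    have p1 := P 1 (by norm_num)
    refine ⟨fun x => (x⁻¹) ^ 3 + (x⁻¹) ^ 6 - c, fun x => sub_ne_zero.2 (hc _), ?_, ?_, ?_, ?_, ?_⟩
    · calc _ = ∑ x : F, (x⁻¹ ^ 3 + x⁻¹ ^ 6 - c * x ^ 0) := by simp
        _ = 0 := by
          rw [Finset.sum_sub_distrib, Finset.sum_add_distrib, ← Finset.mul_sum,
            Q 3 (by norm_num), Q 6 (by norm_num), P 0 (by norm_num)]
          ring
    · calc _ = ∑ x : F, (x⁻¹ ^ 2 + x⁻¹ ^ 5 - c * x ^ 1) := by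
            refine Finset.sum_congr rfl fun x _ => ?_
            by_cases hx : x = 0
            · simp [hx]
            · field_simp
        _ = 0 := by
          rw [Finset.sum_sub_distrib, Finset.sum_add_distrib, ← Finset.mul_sum,
            Q 2 (by norm_num), Q 5 (by norm_num), P 1 (by norm_num)]
          ring
    · calc _ = ∑ x : F, (x⁻¹ ^ 1 + x⁻¹ ^ 4 - c * x ^ 2) := by
            refine Finset.sum_congr rfl fun x _ => ?_
            by_cases hx : x = 0
            · simp [hx]
            · field_simp
        _ = 0 := by
          rw [Finset.sum_sub_distrib, Finset.sum_add_distrib, ← Finset.mul_sum,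
            Q 1 (by norm_num), Q 4 (by norm_num), P 2 (by norm_num)]
          ring
    · calc _ = ∑ x : F, (x ^ 1 + x⁻¹ ^ 2 - c * x ^ 4) := by
            refine Finset.sum_congr rfl fun x _ => ?_
            by_cases hx : x = 0
            · simp [hx]
            · field_simp
        _ = 0 := by
          rw [Finset.sum_sub_distrib, Finset.sum_add_distrib, ← Finset.mul_sum,
            P 1 (by norm_num), Q 2 (by norm_num), P 4 (by norm_num)]
          ring
    · have : ∑ x : F, ((x⁻¹) ^ 3 + (x⁻¹) ^ 6 - c) * x ^ 3 = -1 := by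
        calc _ = ∑ x : F, ((if x = 0 then (0 : F) else 1) + x⁻¹ ^ 3 - c * x ^ 3) := by
              refine Finset.sum_congr rfl fun x _ => ?_
              by_cases hx : x = 0
              · simp [hx]
              · simp only [hx, if_false]
                field_simp
          _ = -1 := by
            rw [Finset.sum_sub_distrib, Finset.sum_add_distrib, ← Finset.mul_sum,
              h3, Q 3 (by norm_num), P 3 (by norm_num)]
            ring
      simp only [this]
      simp

theorem stmt11 {m : ℕ} (hm : 2 ≤ m) {q : ℕ} (hq : q = 2 ^ m)
    {F : Type*} [Field F] [Fintype F] (hcard : Fintype.card F = q) :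
    ∃ D C : Submodule F (Fin (q + 2) → F), D ≤ C ∧
      IsCodeWith (q + 2) 3 q D ∧
      IsCodeWith (q + 2) (q - 1) 4 C := by
  have hq4 : 4 ≤ q := by
    rw [hq]; exact Nat.pow_le_pow_right (n := 2) (by norm_num) hm
  have h2 : (2 : F) = 0 := by
    have hc0 : ((Fintype.card F : ℕ) : F) = 0 := FiniteField.cast_card_eq_zero F
    rw [hcard, hq] at hc0
    push_cast at hc0
    exact pow_eq_zero_iff (by omega) |>.1 hc0
  obtain ⟨w, hw, s0, s1, s2, s4, s3⟩ := exists_w hm (hcard.trans hq)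
  let e : Fin (q + 2) ≃ F ⊕ Bool := Fintype.equivOfCardEq (by simp [hcard])
  let sw : F ⊕ Bool ≃ F ⊕ Bool := Equiv.sumCongr (Equiv.refl F) Equiv.boolNot
  let s := ∑ x, w x * x ^ 3
  have hG : ArcP (hov (fun _ => (1 : F)) 1) := hov_arc h2 _ _ (by simp) one_ne_zero
  have hH : ArcP (hov w s) := hov_arc h2 _ _ hw s3
  let g : Fin (q + 2) → Fin 3 → F := fun i => hov (fun _ => (1 : F)) 1 (sw (e i))
  let h : Fin (q + 2) → Fin 3 → F := fun i => hov w s (e i)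
  have hg : ArcP g := fun i j k a b c => hG _ _ _ (by simpa using a) (by simpa using b)
    (by simpa using c)
  have hh : ArcP h := fun i j k a b c => hH _ _ _ (by simpa using a) (by simpa using b)
    (by simpa using c)
  refine ⟨LinearMap.range (genMap g), LinearMap.ker (chkMap h), ?_,
    arc_gen (by omega) hg, arc_chk (by omega) hh⟩
  rintro _ ⟨a, rfl⟩
  rw [LinearMap.mem_ker]
  ext t
  change ∑ i, (∑ r, g i r * a r) * h i t = 0
  have := Equiv.sum_comp e
    (fun i => (∑ r, hov (fun _ => (1 : F)) 1 (sw i) r * a r) * hov w s i t)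
  refine this.trans ?_
  rw [Fintype.sum_sum_type, Fintype.sum_bool]
  have L : ∀ c0 c1 c2 (f0 f1 f2 : F → F), ∑ x, (c0 * f0 x + c1 * f1 x + c2 * f2 x) =
      c0 * ∑ x, f0 x + c1 * ∑ x, f1 x + c2 * ∑ x, f2 x := by
    intros; simp [Finset.sum_add_distrib, Finset.mul_sum]
  fin_cases t
  · have := L (a 0) (a 1) (a 2) (fun x => w x) (fun x => w x * x) (fun x => w x * x ^ 2)
    rw [s0, s1, s2] at this
    simp [sw, hov, Fin.sum_univ_three]
    rw [← sub_eq_zero.2 this]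
    simp
    rw [← sub_eq_zero, ← Finset.sum_sub_distrib]
    apply Finset.sum_eq_zero; intros; ring
  · have := L (a 0) (a 1) (a 2) (fun x => w x * x) (fun x => w x * x ^ 2) (fun x => w x * x ^ 3)
    rw [s1, s2] at this
    simp [sw, hov, Fin.sum_univ_three]
    have h' : ∑ x, (a 0 + x * a 1 + x ^ 2 * a 2) * (w x * x) = a 2 * s := by
      simp only [mul_zero, zero_add] at this
      rw [← this]
      apply Finset.sum_congr rfl; intros; ring
    rw [h']
    linear_combination a 2 * s * h2
  · have := L (a 0) (a 1) (a 2) (fun x => w x * x ^ 2) (fun x => w x * x ^ 3)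
      (fun x => w x * x ^ 4)
    rw [s2, s4] at this
    simp [sw, hov, Fin.sum_univ_three]
    have h' : ∑ x, (a 0 + x * a 1 + x ^ 2 * a 2) * (w x * x ^ 2) = a 1 * s := by
      simp only [mul_zero, zero_add, add_zero] at this
      rw [← this]
      apply Finset.sum_congr rfl; intros; ring
    rw [h']
    linear_combination a 1 * s * h2
end

section
/- Let q = 2^m with m ≥ 2, let α_1,…,α_{q−1} be an enumeration of the nonzero elements of F_q, and let v_1,…,v_{q+2} be nonzero elements of F_q. Let H be the 3 × (q+2) matrix over F_q with rows (v_1,…,v_{q−1}, v_q, 0, 0), (v_1α_1,…,v_{q−1}α_{q−1}, 0, v_{q+1}, 0), (v_1α_1^2,…,v_{q−1}α_{q−1}^2, 0, 0, v_{q+2}), and let G be the 3 × (q+2) matrix with rows (v_1^{−1},…,v_{q−1}^{−1}, v_q^{−1}, 0, 0), (v_1^{−1}α_1^{−1},…,v_{q−1}^{−1}α_{q−1}^{−1}, 0, v_{q+1}^{−1}, 0), (v_1^{−1}α_1^{−2},…,v_{q−1}^{−1}α_{q−1}^{−2}, 0, 0, v_{q+2}^{−1}). Then G·Hᵀ = 0;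 equivalently, the row space of G is contained in the dual of the row space of H. -/
theorem sum_aux {F : Type*} [Field F] [Fintype F] (n : ℕ) (hn : 3 ≤ n)
    (hcard : Fintype.card F = n + 1) (α : Fin n → F) (hα : Function.Injective α)
    (hα0 : ∀ i, α i ≠ 0) (i k : Fin 3) :
    ∑ j : Fin n, ((α j)⁻¹) ^ (i : ℕ) * (α j) ^ (k : ℕ) = if i = k then -1 else 0 := by
  classical
  have hb : Function.Bijective (fun j => Units.mk0 (α j) (hα0 j)) := by
    rw [Fintype.bijective_iff_injective_and_card]
    refine ⟨fun x y h => hα (by simpa using congrArg Units.val h), ?_⟩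
    rw [Fintype.card_units, hcard]; simp
  have hs := FiniteField.sum_pow_units F (n + k - i)
  rw [hcard, Nat.add_sub_cancel] at hs
  have h1 : ∀ j : Fin n, ((α j)⁻¹) ^ (i : ℕ) * (α j) ^ (k : ℕ)
      = ((Units.mk0 (α j) (hα0 j) : Fˣ) : F) ^ (n + k - i : ℕ) := by
    intro j
    have h0 := hα0 j
    have hp : α j ^ n = 1 := by
      have := FiniteField.pow_card_sub_one_eq_one (α j) h0
      rwa [hcard, Nat.add_sub_cancel] at this
    rw [Units.val_mk0, inv_pow, inv_mul_eq_iff_eq_mul₀ (pow_ne_zero _ h0), ← pow_add,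
      show (i : ℕ) + (n + k - i) = n + k by omega, pow_add, hp, one_mul]
  rw [Finset.sum_congr rfl (fun j _ => h1 j),
    hb.sum_comp (fun x : Fˣ => (x : F) ^ (n + k - i : ℕ))]
  have h2 : n ∣ (n + k - i : ℕ) ↔ i = k := by
    constructor
    · rintro ⟨c, hc⟩
      have : c = 1 := by
        rcases c with _ | _ | c
        · omega
        · rfl
        · exfalso
          have : n * (c + 1 + 1) = n * c + n + n := by ring
          have := Nat.zero_le (n * c)
          omega
      subst this
      ext; omega
    · rintro rfl
      simp
  rw [← if_congr h2 rfl rfl, ← hs]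

theorem stmt12 {m : ℕ} (hm : 2 ≤ m) {q : ℕ} (hq : q = 2 ^ m)
    {F : Type*} [Field F] [Fintype F] (hcard : Fintype.card F = q)
    -- `α` enumerates the nonzero elements of `F`:
    (α : Fin (q - 1) → F) (hα : Function.Injective α) (hα0 : ∀ i, α i ≠ 0)
    (v : Fin (q + 2) → F) (hv : ∀ i, v i ≠ 0)
    (H G : Matrix (Fin 3) (Fin (q + 2)) F)
    -- row `i` of `H` is `(v₁ α₁^i, …, v_{q-1} α_{q-1}^i, …)` with
    -- `v_q, v_{q+1}, v_{q+2}` on a diagonal in the last three columns: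
    (hH : H = Matrix.of fun (i : Fin 3) (j : Fin (q + 2)) =>
      if h : (j : ℕ) < q - 1 then v j * (α ⟨j, h⟩) ^ (i : ℕ)
      else if (j : ℕ) = q - 1 + (i : ℕ) then v j else 0)
    -- row `i` of `G` is `(v₁⁻¹ α₁⁻ⁱ, …, v_{q-1}⁻¹ α_{q-1}⁻ⁱ, …)` with
    -- `v_q⁻¹, v_{q+1}⁻¹, v_{q+2}⁻¹` on a diagonal in the last three columns:
    (hG : G = Matrix.of fun (i : Fin 3) (j : Fin (q + 2)) =>
      if h : (j : ℕ) < q - 1 then (v j)⁻¹ * ((α ⟨j, h⟩)⁻¹) ^ (i : ℕ)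
      else if (j : ℕ) = q - 1 + (i : ℕ) then (v j)⁻¹ else 0) :
    G * H.transpose = 0 := by
  have hq4 : 4 ≤ q := by
    rw [hq]
    calc 4 = 2 ^ 2 := by norm_num
      _ ≤ 2 ^ m := Nat.pow_le_pow_right (by norm_num) hm
  clear hq hm
  obtain ⟨n, rfl⟩ : ∃ n, q = n + 1 := ⟨q - 1, by omega⟩
  have key : ∀ i k : Fin 3, ∑ j : Fin n, ((α j)⁻¹) ^ (i : ℕ) * (α j) ^ (k : ℕ)
      = if i = k then -1 else 0 := fun i k => sum_aux n (by omega) hcard α hα hα0 i k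
  subst hH hG
  ext i k
  rw [Matrix.mul_apply, Fin.sum_univ_castSucc, Fin.sum_univ_castSucc, Fin.sum_univ_castSucc]
  have h1 : ∀ j : Fin n, (v j.castSucc.castSucc.castSucc)⁻¹ * ((α j)⁻¹) ^ (i : ℕ) *
      (v j.castSucc.castSucc.castSucc * (α j) ^ (k : ℕ)) =
      ((α j)⁻¹) ^ (i : ℕ) * (α j) ^ (k : ℕ) := by
    intro j
    have := hv j.castSucc.castSucc.castSucc
    rw [mul_mul_mul_comm, inv_mul_cancel₀ this, one_mul]
  have h2 := key i k
  rw [← Finset.sum_congr rfl (fun j _ => h1 j)] at h2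
  have a := hv (Fin.last n).castSucc.castSucc
  have b := hv (Fin.last (n+1)).castSucc
  have c := hv (Fin.last (n+2))
  simp only [Matrix.transpose_apply, Matrix.of_apply, Fin.val_castSucc, Fin.val_last,
    Nat.add_sub_cancel, Fin.is_lt, dite_true, Fin.eta]
  rw [h2]
  fin_cases i <;> fin_cases k <;> simp [a, b, c]
end

section
/- Let q ≥ 4 be a prime power and k an integer with 3 ≤ k ≤ q−1. Then there exists a linear [q+1, k, q−k+2]_q MDS code C′ containing a codeword of full Hamming weight q+1; in particular there exist nested F_q-linear codes C ⊂ C′ with C a linear [q+1, 1, q+1]_q MDS code. -/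
open Classical in
lemma hWt_cons_aux_s16 {F : Type*} [Field F] [Fintype F] {q : ℕ} (e : Fin q ≃ F) (c : F) (g : F → F) :
    hWt (Fin.cons c (fun i => g (e i)) : Fin (q+1) → F) + (if c = 0 then 1 else 0)
      + (Finset.univ.filter fun x => g x = 0).card = q + 1 := by
  have hq : Fintype.card F = q := by simpa using (Fintype.card_congr e).symm
  have h1 : hWt (Fin.cons c (fun i => g (e i)) : Fin (q+1) → F)
      = (if c ≠ 0 then 1 else 0) + (Finset.univ.filter fun x => g x ≠ 0).card := by
    unfold hWt
    rw [Finset.card_filter, Finset.card_filter, Fin.sum_univ_succ]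
    simp only [Fin.cons_zero, Fin.cons_succ]
    congr 1
    exact Equiv.sum_comp e (fun x => if g x ≠ 0 then 1 else 0)
  have h2 := Finset.card_filter_add_card_filter_not (s := (Finset.univ : Finset F)) (fun x => g x = 0)
  rw [Finset.card_univ, hq] at h2
  rw [h1]
  by_cases hc : c = 0 <;> simp [hc] at * <;> omega

/-- evaluation map of the extended Reed-Solomon code -/
noncomputable def ersMap {F : Type*} [Field F] {q : ℕ} (e : Fin q → F) (k : ℕ) :
    Polynomial.degreeLT F k →ₗ[F] (Fin (q+1) → F) where
  toFun f := Fin.cons ((f : Polynomial F).coeff (k-1)) (fun i => (f : Polynomial F).eval (e i))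
  map_add' f g := by
    funext i
    refine Fin.cases ?_ (fun j => ?_) i <;> simp
  map_smul' c g := by
    funext i
    refine Fin.cases ?_ (fun j => ?_) i <;> simp

open Classical in
lemma ers_zeros {F : Type*} [Field F] [Fintype F] {k : ℕ} (hk : 2 ≤ k) (f : Polynomial F)
    (hf : f ∈ Polynomial.degreeLT F k) (h0 : f ≠ 0) :
    (if f.coeff (k-1) = 0 then 1 else 0) + (Finset.univ.filter fun x => f.eval x = 0).card ≤ k - 1 := by
  have hd : f.natDegree < k := by
    rw [Polynomial.mem_degreeLT] at hf
    exact (Polynomial.natDegree_lt_iff_degree_lt h0).2 hf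
  have hr : (Finset.univ.filter fun x => f.eval x = 0).card ≤ f.natDegree := by
    refine Polynomial.card_le_degree_of_subset_roots ?_
    intro x hx
    simp at hx
    simpa [h0] using hx
  split_ifs with hc
  · have : f.natDegree ≠ k - 1 := by
      intro h
      rw [← h] at hc
      exact h0 (Polynomial.leadingCoeff_eq_zero.1 hc)
    omega
  · omega

lemma exists_noroot {F : Type*} [Field F] [Fintype F] (m : ℕ) (hm : 2 ≤ m) :
    ∃ c : F, ∀ x : F, x ^ m - x ^ (m-1) - c ≠ 0 := by
  have : ¬ Function.Surjective (fun x : F => x ^ m - x ^ (m-1)) := by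
    intro h
    have hi := Finite.injective_iff_surjective.2 h
    have : (0:F) = 1 := hi (by
      have h1 : m ≠ 0 := by omega
      have h2 : m - 1 ≠ 0 := by omega
      simp [h1, h2])
    exact zero_ne_one this
  simp only [Function.Surjective, not_forall, not_exists] at this
  obtain ⟨c, hc⟩ := this
  exact ⟨c, fun x h => hc x (sub_eq_zero.1 h)⟩

theorem stmt16 {q k : ℕ} (hq : IsPrimePow q) (hq4 : 4 ≤ q)
    {F : Type*} [Field F] [Fintype F] (hcard : Fintype.card F = q)
    (hk3 : 3 ≤ k) (hkq : k ≤ q - 1) :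
    ∃ C' : Submodule F (Fin (q + 1) → F),
      IsCodeWith (q + 1) k (q - k + 2) C' ∧
      (∃ w ∈ C', ∀ i, w i ≠ 0) ∧
      ∃ C : Submodule F (Fin (q + 1) → F), C < C' ∧ IsCodeWith (q + 1) 1 (q + 1) C := by
  classical
  let e : Fin q ≃ F := (Fintype.equivFinOfCardEq hcard).symm
  have hwt : ∀ f : Polynomial.degreeLT F k, f ≠ 0 → q - k + 2 ≤ hWt (ersMap e k f) := by
    intro f hf
    have h1 := ers_zeros (by omega) f.1 f.2 (fun h => hf (Subtype.ext h))
    have h2 := hWt_cons_aux_s16 e (f.1.coeff (k-1)) (fun x => f.1.eval x)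
    change hWt (ersMap e k f) + _ + _ = _ at h2
    omega
  have hinj : Function.Injective (ersMap (F := F) e k) := by
    rw [← LinearMap.ker_eq_bot, LinearMap.ker_eq_bot']
    intro f hf
    by_contra h
    have := hwt f h
    rw [hf] at this
    simp [hWt] at this
  have hfr : Module.finrank F (LinearMap.range (ersMap (F := F) e k)) = k := by
    rw [LinearMap.finrank_range_of_inj hinj, (Polynomial.degreeLTEquiv F k).finrank_eq]
    simp
  have hfull : ∃ w ∈ LinearMap.range (ersMap (F := F) e k), ∀ i, w i ≠ 0 := by
    obtain ⟨c, hc⟩ := exists_noroot (F := F) (k-1) (by omega)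
    let p : Polynomial F := Polynomial.X ^ (k-1) - Polynomial.X ^ (k-1-1) - Polynomial.C c
    have hp : p ∈ Polynomial.degreeLT F k := by
      refine Submodule.sub_mem _ (Submodule.sub_mem _ ?_ ?_) ?_ <;> rw [Polynomial.mem_degreeLT]
      · rw [Polynomial.degree_X_pow]; exact_mod_cast (by omega : k - 1 < k)
      · rw [Polynomial.degree_X_pow]; exact_mod_cast (by omega : k - 1 - 1 < k)
      · exact lt_of_le_of_lt Polynomial.degree_C_le (by exact_mod_cast (by omega : 0 < k))
    refine ⟨_, ⟨⟨p, hp⟩, rfl⟩, ?_⟩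
    intro i
    refine Fin.cases ?_ (fun j => ?_) i
    · have h1 : k - 1 ≠ k - 1 - 1 := by omega
      have h2 : k - 1 ≠ 0 := by omega
      simp [ersMap, p, Polynomial.coeff_X_pow, Polynomial.coeff_C, h1, h2]
    · simpa [ersMap, p] using hc (e j)
  refine ⟨LinearMap.range (ersMap (F := F) e k), ⟨hfr, ?_, ?_⟩, hfull, ?_⟩
  · obtain ⟨S, -, hS⟩ := Finset.exists_subset_card_eq (s := (Finset.univ : Finset F)) (n := k-1)
      (by rw [Finset.card_univ]; omega)
    let p : Polynomial F := ∏ a ∈ S, (Polynomial.X - Polynomial.C a)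
    have hm : p.Monic := Polynomial.monic_prod_of_monic _ _ fun a _ => Polynomial.monic_X_sub_C a
    have hd : p.natDegree = k - 1 := by
      simp [p, Polynomial.natDegree_finsetProd_X_sub_C_eq_card, hS]
    have hp : p ∈ Polynomial.degreeLT F k := by
      rw [Polynomial.mem_degreeLT, ← Polynomial.natDegree_lt_iff_degree_lt hm.ne_zero]
      omega
    have hne : (⟨p, hp⟩ : Polynomial.degreeLT F k) ≠ 0 := fun h => hm.ne_zero (congrArg Subtype.val h)
    refine ⟨_, ⟨⟨p, hp⟩, rfl⟩, ?_, ?_⟩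
    · exact fun h => hne (hinj (by rw [h, map_zero]))
    · have h2 := hWt_cons_aux_s16 e (p.coeff (k-1)) (fun x => p.eval x)
      change hWt (ersMap e k ⟨p, hp⟩) + _ + _ = _ at h2
      have h3 : p.coeff (k-1) = 1 := by rw [← hd]; exact hm
      have h4 : (Finset.univ.filter fun x => p.eval x = 0) = S := by
        ext x
        simp [p, Polynomial.eval_prod, Finset.prod_eq_zero_iff, sub_eq_zero]
      simp only [h3, h4, hS, one_ne_zero, if_false] at h2
      omega
  · rintro v ⟨f, rfl⟩ hv
    exact hwt f (fun h => hv (by rw [h, map_zero]))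
  · obtain ⟨w, hw, hw0⟩ := hfull
    have hwne : w ≠ 0 := fun h => hw0 0 (by rw [h]; rfl)
    have h1 : Module.finrank F (Submodule.span F {w}) = 1 := finrank_span_singleton hwne
    have hfw : ∀ v : Fin (q+1) → F, (∀ i, v i ≠ 0) → hWt v = q + 1 := by
      intro v hv
      simp [hWt, hv]
    refine ⟨Submodule.span F {w}, lt_of_le_of_ne ?_ ?_, h1, ⟨w, Submodule.mem_span_singleton_self w, hwne, hfw w hw0⟩, ?_⟩
    · rw [Submodule.span_singleton_le_iff_mem]; exact hw
    · intro h
      rw [h, hfr] at h1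
      omega
    · intro v hv hv0
      obtain ⟨a, rfl⟩ := Submodule.mem_span_singleton.1 hv
      have ha : a ≠ 0 := fun h => hv0 (by rw [h, zero_smul])
      exact (hfw _ fun i => by simp [ha, hw0 i]).ge
end

section
/- Let q = 2^m with m ≥ 2. Then there exists a linear [q+2, 3, q]_q MDS code containing a codeword of full Hamming weight q+2, and there exists a linear [q+2, q−1, 4]_q MDS code containing a codeword of full Hamming weight q+2; in particular, for each of these codes C′ there exist nested F_q-linear codes C ⊂ C′ with C a linear [q+2, 1, q+2]_q MDS code. -/
def hP0 {F : Type*} [Field F] : Option (Option F) → F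
  | none => 0
  | some none => 0
  | some (some _) => 1

def hP1 {F : Type*} [Field F] : Option (Option F) → F
  | none => 0
  | some none => 1
  | some (some t) => t

def hP2 {F : Type*} [Field F] : Option (Option F) → F
  | none => 1
  | some none => 0
  | some (some t) => t ^ 2

lemma hyper_zero {F : Type*} [Field F] [CharP F 2] (a b c : F) (i j k : Option (Option F))
    (hij : i ≠ j) (hik : i ≠ k) (hjk : j ≠ k)
    (hi : a * hP0 i + b * hP1 i + c * hP2 i = 0)
    (hj : a * hP0 j + b * hP1 j + c * hP2 j = 0)
    (hk : a * hP0 k + b * hP1 k + c * hP2 k = 0) : a = 0 ∧ b = 0 ∧ c = 0 := by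
  have h2 : (2 : F) = 0 := CharP.cast_eq_zero F 2
  rcases i with _ | _ | t <;> rcases j with _ | _ | s <;> rcases k with _ | _ | r <;>
    simp [hP0, hP1, hP2] at * <;> grind

lemma hyper_indep {F : Type*} [Field F] [CharP F 2] (x y z : F) (i j k : Option (Option F))
    (hij : i ≠ j) (hik : i ≠ k) (hjk : j ≠ k)
    (h0 : x * hP0 i + y * hP0 j + z * hP0 k = 0)
    (h1 : x * hP1 i + y * hP1 j + z * hP1 k = 0)
    (h2 : x * hP2 i + y * hP2 j + z * hP2 k = 0) : x = 0 ∧ y = 0 ∧ z = 0 := by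
  have h2 : (2 : F) = 0 := CharP.cast_eq_zero F 2
  rcases i with _ | _ | t <;> rcases j with _ | _ | s <;> rcases k with _ | _ | r <;>
    simp [hP0, hP1, hP2] at * <;> grind

lemma sub_code {F : Type*} [Field F] {n : ℕ} (hn : 0 < n) (C' : Submodule F (Fin n → F))
    (h : 1 < Module.finrank F C') (w : Fin n → F) (hw : w ∈ C') (hw0 : ∀ i, w i ≠ 0) :
    ∃ C : Submodule F (Fin n → F), C < C' ∧ IsCodeWith n 1 n C := by
  have hne : w ≠ 0 := fun h => hw0 ⟨0, hn⟩ (by simp [h])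
  have hr : Module.finrank F (Submodule.span F {w}) = 1 := finrank_span_singleton hne
  refine ⟨Submodule.span F {w}, lt_of_le_of_ne ?_ ?_, hr, ⟨w, ?_, hne, ?_⟩, ?_⟩
  · simpa [Submodule.span_le] using hw
  · intro h'
    rw [h'] at hr
    omega
  · exact Submodule.mem_span_singleton_self w
  · simp [hWt, hw0]
  · intro v hv hv0
    obtain ⟨a, rfl⟩ := Submodule.mem_span_singleton.1 hv
    have ha : a ≠ 0 := by rintro rfl; simp at hv0
    simp [hWt, hw0, ha]

def enc {F : Type*} [Field F] {n : ℕ} (e : Fin n → Option (Option F)) :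
    (F × F × F) →ₗ[F] (Fin n → F) where
  toFun p i := p.1 * hP0 (e i) + p.2.1 * hP1 (e i) + p.2.2 * hP2 (e i)
  map_add' p p' := by ext i; simp; ring
  map_smul' a p := by ext i; simp; ring

def chk {F : Type*} [Field F] {n : ℕ} (e : Fin n → Option (Option F)) :
    (Fin n → F) →ₗ[F] (F × F × F) where
  toFun v := (∑ i, v i * hP0 (e i), ∑ i, v i * hP1 (e i), ∑ i, v i * hP2 (e i))
  map_add' p p' := by simp [add_mul, Finset.sum_add_distrib]
  map_smul' a p := by simp [mul_assoc, Finset.mul_sum]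

lemma code1 {q : ℕ} (hq4 : 4 ≤ q) {F : Type*} [Field F] [Fintype F] [CharP F 2]
    (e : Fin (q + 2) ≃ Option (Option F)) :
    IsCodeWith (q + 2) 3 q (LinearMap.range (enc e)) ∧
      ∃ w ∈ LinearMap.range (enc e), ∀ i, w i ≠ 0 := by
  classical
  have h2 : (2 : F) = 0 := CharP.cast_eq_zero F 2
  have key : ∀ p : F × F × F, p ≠ 0 →
      (Finset.univ.filter fun i => enc e p i = 0).card ≤ 2 := by
    intro p hp
    by_contra! hc
    obtain ⟨i, j, k, hi, hj, hk, hij, hik, hjk⟩ := Finset.two_lt_card_iff.1 hc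
    simp only [Finset.mem_filter, Finset.mem_univ, true_and] at hi hj hk
    obtain ⟨ha, hb, hc⟩ := hyper_zero p.1 p.2.1 p.2.2 (e i) (e j) (e k) (by simpa) (by simpa)
      (by simpa) hi hj hk
    exact hp (Prod.ext ha (Prod.ext hb hc))
  have hadd : ∀ v : Fin (q+2) → F,
      (Finset.univ.filter fun i => v i = 0).card + hWt v = q + 2 := by
    intro v
    have := Finset.card_filter_add_card_filter_not (s := (Finset.univ : Finset (Fin (q+2))))
      (fun i => v i = 0)
    simp only [Finset.card_univ, Fintype.card_fin] at this
    refine Eq.trans ?_ this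
    unfold hWt; congr!
  have hmin : ∀ p : F × F × F, p ≠ 0 → q ≤ hWt (enc e p) := by
    intro p hp
    have := key p hp
    have := hadd (enc e p)
    omega
  have hinj : Function.Injective (enc e) := by
    rw [injective_iff_map_eq_zero]
    intro p hp
    by_contra h
    have := hmin p h
    rw [hp] at this
    simp [hWt] at this
    omega
  refine ⟨⟨?_, ⟨enc e (0, 0, 1), ⟨_, rfl⟩, ?_, ?_⟩, ?_⟩, ?_⟩
  · rw [LinearMap.finrank_range_of_inj hinj]; simp
  · rw [Ne, map_eq_zero_iff _ hinj]; simp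
  · have h1 := hmin (0, 0, 1) (by simp)
    have h3 := hadd (enc e (0, 0, 1))
    have h4 : ({e.symm (some none), e.symm (some (some 0))} : Finset (Fin (q+2))) ⊆
        (Finset.univ.filter fun i => enc e (0, 0, 1) i = 0) := by
      intro i hi
      simp only [Finset.mem_insert, Finset.mem_singleton] at hi
      rcases hi with rfl | rfl <;> simp [enc, hP0, hP1, hP2]
    have h5 := Finset.card_le_card h4
    rw [Finset.card_pair (by simp)] at h5
    omega
  · rintro v ⟨p, rfl⟩ hv
    exact hmin p (by rintro rfl; simp at hv)
  · have hns : ¬ Function.Surjective (fun t : F => t ^ 2 + t) := by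
      rw [← Finite.injective_iff_surjective]
      intro h
      have := @h 0 1 (by simp; grind)
      simp at this
    simp only [Function.Surjective, not_forall, not_exists] at hns
    obtain ⟨a, ha⟩ := hns
    refine ⟨enc e (a, 1, 1), ⟨_, rfl⟩, fun i => ?_⟩
    simp only [enc, LinearMap.coe_mk, AddHom.coe_mk]
    rcases e i with _ | _ | t <;> simp [hP0, hP1, hP2]
    have := ha t
    grind

def wrd {F : Type*} (c b : F) (f : F → F) : Option (Option F) → F
  | none => c
  | some none => b
  | some (some t) => f t

lemma code2 {q : ℕ} (hq4 : 4 ≤ q) {F : Type*} [Field F] [Fintype F] [CharP F 2]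
    (hcard : Fintype.card F = q) (e : Fin (q + 2) ≃ Option (Option F)) :
    IsCodeWith (q + 2) (q - 1) 4 (LinearMap.ker (chk e)) ∧
      ∃ w ∈ LinearMap.ker (chk e), ∀ i, w i ≠ 0 := by
  classical
  have h2 : (2 : F) = 0 := CharP.cast_eq_zero F 2
  have hchk : ∀ u : Option (Option F) → F, chk e (fun i => u (e i)) =
      (∑ i, u i * hP0 i, ∑ i, u i * hP1 i, ∑ i, u i * hP2 i) := by
    intro u
    simp only [chk, LinearMap.coe_mk, AddHom.coe_mk]
    rw [← Equiv.sum_comp e, ← Equiv.sum_comp e, ← Equiv.sum_comp e]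
  have hmin : ∀ v ∈ LinearMap.ker (chk e), v ≠ 0 → 4 ≤ hWt v := by
    intro v hv hv0
    by_contra! hc
    obtain ⟨T, hST, hT⟩ := Finset.exists_superset_card_eq (n := 3)
      (s := Finset.univ.filter fun i => v i ≠ 0)
      (by unfold hWt at hc; convert Nat.lt_succ_iff.1 hc) (by simp; omega)
    have hout : ∀ i, i ∉ T → v i = 0 := by
      intro i hi
      by_contra h
      exact hi (hST (by simpa using h))
    obtain ⟨i, j, k, hij, hik, hjk, rfl⟩ := Finset.card_eq_three.1 hT
    have hsum : ∀ g : Fin (q+2) → F, ∑ l, v l * g l = v i * g i + v j * g j + v k * g k := by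
      intro g
      rw [← Finset.sum_subset (Finset.subset_univ {i, j, k})
        (fun l _ hl => by rw [hout l hl, zero_mul])]
      rw [Finset.sum_insert (by simp [hij, hik]), Finset.sum_pair hjk, add_assoc]
    simp only [LinearMap.mem_ker, chk, LinearMap.coe_mk, AddHom.coe_mk, hsum, Prod.mk_eq_zero] at hv
    obtain ⟨hx, hy, hz⟩ := hyper_indep (v i) (v j) (v k) (e i) (e j) (e k) (by simpa) (by simpa)
      (by simpa) hv.1 hv.2.1 hv.2.2
    apply hv0
    ext l
    by_cases hl : l ∈ ({i, j, k} : Finset _)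
    · simp only [Finset.mem_insert, Finset.mem_singleton] at hl
      rcases hl with rfl | rfl | rfl <;> assumption
    · exact hout l hl
  have hsurj : Function.Surjective (chk e) := by
    rintro ⟨a, b, c⟩
    refine ⟨fun i => wrd c b (fun t => if t = 0 then a else 0) (e i), ?_⟩
    rw [hchk (wrd _ _ _)]
    simp [Fintype.sum_option, wrd, hP0, hP1, hP2]
  have s0 : ∑ t : F, (1 : F) = 0 := by
    have := FiniteField.sum_pow_lt_card_sub_one F 0 (by omega)
    simpa using this
  have s1 : ∑ t : F, t = 0 := by
    have := FiniteField.sum_pow_lt_card_sub_one F 1 (by omega)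
    simpa using this
  have s2 : ∑ t : F, t ^ 2 = 0 := FiniteField.sum_pow_lt_card_sub_one F 2 (by omega)
  refine ⟨⟨?_, ?_, hmin⟩, ?_⟩
  · have := LinearMap.finrank_range_add_finrank_ker (chk e)
    rw [LinearMap.range_eq_top.2 hsurj] at this
    simp at this
    omega
  · set v : Fin (q+2) → F := fun i => wrd 1 1 (fun t => (if t = 0 then 1 else 0) + (if t = 1 then 1 else 0)) (e i) with hv
    have hm : v ∈ LinearMap.ker (chk e) := by
      rw [LinearMap.mem_ker, hv, hchk (wrd _ _ _)]
      simp [Fintype.sum_option, wrd, hP0, hP1, hP2, add_mul, Finset.sum_add_distrib]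
      grind
    have hne : v ≠ 0 := by
      intro h
      have := congrFun h (e.symm none)
      simp [hv, wrd] at this
    refine ⟨v, hm, hne, le_antisymm ?_ (hmin v hm hne)⟩
    have hsub : (Finset.univ.filter fun i => v i ≠ 0) ⊆
      {e.symm none, e.symm (some none), e.symm (some (some 0)), e.symm (some (some 1))} := by
      intro i hi
      obtain ⟨o, rfl⟩ := e.symm.surjective i
      simp only [Finset.mem_filter, Finset.mem_univ, true_and, hv, Equiv.apply_symm_apply] at hi
      rcases o with _ | _ | t
      · simp
      · simp
      · by_cases h0 : t = 0
        · simp [h0]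
        · by_cases h1 : t = 1
          · simp [h1]
          · simp [wrd, h0, h1] at hi
    have h5 := (Finset.card_le_card hsub).trans Finset.card_le_four
    unfold hWt
    convert h5
  · obtain ⟨x, hx⟩ : ∃ x : F, x ∉ ({0, 1} : Finset F) := by
      by_contra! h
      have h1 : (Finset.univ : Finset F) ⊆ {0, 1} := fun x _ => h x
      have := (Finset.card_le_card h1).trans Finset.card_le_two
      rw [Finset.card_univ] at this
      omega
    simp only [Finset.mem_insert, Finset.mem_singleton, not_or] at hx
    refine ⟨fun i => wrd x x (fun t => 1 + (if t = 0 then x else 0) + (if t = 1 then x else 0)) (e i), ?_, ?_⟩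
    · rw [LinearMap.mem_ker, hchk (wrd _ _ _)]
      simp only [Finset.sum_const, Finset.card_univ, nsmul_eq_mul, mul_one] at s0
      simp [Fintype.sum_option, wrd, hP0, hP1, hP2, add_mul, Finset.sum_add_distrib, s0, s1, s2]
      grind
    · intro i
      dsimp only
      rcases e i with _ | _ | t
      · simpa [wrd] using hx.1
      · simpa [wrd] using hx.1
      · have := hx.2
        by_cases h0 : t = 0
        · simp [wrd, h0]; grind
        · by_cases h1 : t = 1
          · simp [wrd, h1]; grind
          · simp [wrd, h0, h1]

theorem stmt17 {m : ℕ} (hm : 2 ≤ m) {q : ℕ} (hq : q = 2 ^ m)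
    {F : Type*} [Field F] [Fintype F] (hcard : Fintype.card F = q) :
    (∃ C' : Submodule F (Fin (q + 2) → F),
      IsCodeWith (q + 2) 3 q C' ∧
      (∃ w ∈ C', ∀ i, w i ≠ 0) ∧
      ∃ C : Submodule F (Fin (q + 2) → F), C < C' ∧ IsCodeWith (q + 2) 1 (q + 2) C) ∧
    (∃ C' : Submodule F (Fin (q + 2) → F),
      IsCodeWith (q + 2) (q - 1) 4 C' ∧
      (∃ w ∈ C', ∀ i, w i ≠ 0) ∧
      ∃ C : Submodule F (Fin (q + 2) → F), C < C' ∧ IsCodeWith (q + 2) 1 (q + 2) C) := by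
  have hq4 : 4 ≤ q := by
    rw [hq]; calc 4 = 2 ^ 2 := by norm_num
      _ ≤ 2 ^ m := Nat.pow_le_pow_right (by norm_num) hm
  haveI : CharP F 2 := by
    haveI : Fact (Nat.Prime 2) := ⟨Nat.prime_two⟩
    exact charP_of_card_eq_prime_pow (f := m) (by rw [hcard, hq])
  have e : Fin (q + 2) ≃ Option (Option F) :=
    (Fintype.equivFinOfCardEq (by simp [hcard])).symm
  obtain ⟨h1, w1, hw1, hw1'⟩ := code1 hq4 e
  obtain ⟨h2, w2, hw2, hw2'⟩ := code2 hq4 hcard e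
  exact ⟨⟨_, h1, ⟨w1, hw1, hw1'⟩, sub_code (by omega) _ (by rw [h1.1]; omega) w1 hw1 hw1'⟩,
    ⟨_, h2, ⟨w2, hw2, hw2'⟩, sub_code (by omega) _ (by rw [h2.1]; omega) w2 hw2 hw2'⟩⟩
end
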